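/- arXiv:1610.06060 — 2 statements merged into one kernel-verified Lean document; each statement's English description precedes it below -/
import Mathlib

section
/- Let (G, B) be a biased graph, v₀ ∈ V(G), and let S ⊆ V(G) with v₀ ∈ S and G[S] balanced (containing no unbalanced cycle). Let V_R ⊆ V with v₀ ∈ V_R, G[V_R] balanced and connected, and let U be the connected component of v₀ in G[S ∩ V_R]. Suppose V_{1/2} ⊆ N(V_R) is a set of vertices such that no unbalanced cycle meets N(V_R) in exactly one vertex of V_{1/2} while otherwise staying in V_R (formally: any unbalanced cycle contained in V_R ∪ {a} for a ∈ V_{1/2} does not exist, i.e., V_{1/2} ∩ V₁ = ∅ where V₁ are vertices v with an unbalanced cycle in G[V_R + v]). Then the set S' = V_R ∪ (N(U) ∩ V_{1/2} ∩ S) ∪ (S ∖ N[V_R]) induces a balanced subgraph G[S']. -/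
open SimpleGraph

/-- The open neighbourhood `N(S)` of a vertex set. -/
def nbhd {V : Type*} (G : SimpleGraph V) (S : Set V) : Set V :=
  {v | v ∉ S ∧ ∃ u ∈ S, G.Adj u v}

/-- Three internally vertex-disjoint paths between two distinct vertices: a theta graph. -/
def IsTheta {V : Type*} (G : SimpleGraph V) {a b : V} (p1 p2 p3 : G.Walk a b) : Prop :=
  a ≠ b ∧ p1.IsPath ∧ p2.IsPath ∧ p3.IsPath ∧
  (∀ x, x ∈ p1.support → x ∈ p2.support → x = a ∨ x = b) ∧
  (∀ x, x ∈ p1.support → x ∈ p3.support → x = a ∨ x = b) ∧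
  (∀ x, x ∈ p2.support → x ∈ p3.support → x = a ∨ x = b)

/-- A class of balanced cycles (given by their edge sets) is linear if whenever two
balanced cycles form a theta graph, the third cycle of the theta is balanced. -/
def IsLinearClass {V : Type*} (G : SimpleGraph V) (Bal : Set (Sym2 V) → Prop) : Prop :=
  ∀ (a b : V) (p1 p2 p3 : G.Walk a b), IsTheta G p1 p2 p3 →
    Bal {e | e ∈ p1.edges ∨ e ∈ p2.edges} →
    Bal {e | e ∈ p1.edges ∨ e ∈ p3.edges} →
    Bal {e | e ∈ p2.edges ∨ e ∈ p3.edges}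

/-- `G[A]` is balanced: every simple cycle with all vertices in `A` is balanced. -/
def BalancedOn {V : Type*} (G : SimpleGraph V) (Bal : Set (Sym2 V) → Prop) (A : Set V) : Prop :=
  ∀ (u : V) (w : G.Walk u u), w.IsCycle → (∀ y ∈ w.support, y ∈ A) →
    Bal {e | e ∈ w.edges}


namespace BG
variable {V : Type*} {G : SimpleGraph V}

theorem isPath_append_iff {a b c : V} (p : G.Walk a b) (q : G.Walk b c) :
    (p.append q).IsPath ↔ p.IsPath ∧ q.IsPath ∧
      ∀ x, x ∈ p.support → x ∈ q.support → x = b := by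
  rw [Walk.isPath_def, Walk.isPath_def, Walk.isPath_def, Walk.support_append, List.nodup_append]
  have hq : q.support = b :: q.support.tail := q.cons_tail_support.symm
  have hb : b ∈ p.support := p.end_mem_support
  generalize q.support.tail = l at hq ⊢
  rw [hq, List.nodup_cons]
  grind

/-- Two internally disjoint paths. -/
def DP {a b : V} (p q : G.Walk a b) : Prop :=
  p.IsPath ∧ q.IsPath ∧ ∀ x, x ∈ p.support → x ∈ q.support → x = a ∨ x = b

/-- Balancedness in terms of pairs of paths. -/
def BalP (G : SimpleGraph V) (Bal : Set (Sym2 V) → Prop) (A : Set V) : Prop :=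
  ∀ (a b : V) (p q : G.Walk a b), a ≠ b → DP p q → p ≠ q →
    (∀ y, y ∈ p.support ∨ y ∈ q.support → y ∈ A) → Bal {e | e ∈ p.edges ∨ e ∈ q.edges}

theorem BalP.mono {Bal : Set (Sym2 V) → Prop} {A B : Set V} (h : BalP G Bal B) (hAB : A ⊆ B) :
    BalP G Bal A := fun a b p q h1 h2 h3 h4 => h a b p q h1 h2 h3 fun y hy => hAB (h4 y hy)

theorem bal_congr {Bal : Set (Sym2 V) → Prop} {s t : Set (Sym2 V)} (h : Bal s)
    (hst : ∀ e, e ∈ s ↔ e ∈ t) : Bal t := by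
  have : s = t := Set.ext hst
  exact this ▸ h

theorem first_hit (M : Set V) {a b : V} (w : G.Walk a b) (h : ∃ z ∈ w.support, z ∈ M) :
    ∃ (y : V) (w1 : G.Walk a y) (w2 : G.Walk y b), w = w1.append w2 ∧ y ∈ M ∧
      ∀ z ∈ w1.support, z ∈ M → z = y := by
  induction w with
  | nil =>
    rename_i u
    refine ⟨u, Walk.nil, Walk.nil, rfl, ?_, ?_⟩
    · simpa using h
    · simp
  | cons hadj t ih =>
    rename_i u v w
    by_cases hu : u ∈ M
    · refine ⟨u, Walk.nil, Walk.cons hadj t, rfl, hu, ?_⟩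
      simp
    · obtain ⟨y, w1, w2, h1, h2, h3⟩ := ih (by
        obtain ⟨z, hz, hzM⟩ := h
        rw [Walk.support_cons, List.mem_cons] at hz
        rcases hz with rfl | hz
        · exact absurd hzM hu
        · exact ⟨z, hz, hzM⟩)
      refine ⟨y, Walk.cons hadj w1, w2, by rw [h1, Walk.cons_append], h2, ?_⟩
      intro z hz hzM
      rw [Walk.support_cons, List.mem_cons] at hz
      rcases hz with rfl | hz
      · exact absurd hzM hu
      · exact h3 z hz hzM

theorem DP.isCycle {a b : V} {p q : G.Walk a b} (hab : a ≠ b) (h : DP p q) (hne : p ≠ q) :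
    (p.append q.reverse).IsCycle := by
  obtain ⟨hp, hq, hd⟩ := h
  cases p with
  | nil => exact absurd rfl hab
  | cons hadj t =>
    rename_i c
    rw [Walk.cons_append, Walk.cons_isCycle_iff]
    rw [Walk.cons_isPath_iff] at hp
    refine ⟨?_, ?_⟩
    · rw [isPath_append_iff]
      refine ⟨hp.1, hq.reverse, ?_⟩
      intro x hx hx'
      rw [Walk.support_reverse, List.mem_reverse] at hx'
      have := hd x (by rw [Walk.support_cons]; exact List.mem_cons_of_mem _ hx) hx'
      grind
    · intro he
      rw [Walk.edges_append, List.mem_append] at he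
      rcases he with he | he
      · exact hp.2 (t.fst_mem_support_of_mem_edges he)
      · rw [Walk.edges_reverse, List.mem_reverse] at he
        have hc := hd c (by simp) (q.snd_mem_support_of_mem_edges he)
        have hcb : c = b := by
          rcases hc with rfl | h
          · exact absurd hadj (G.irrefl)
          · exact h
        subst hcb
        have ht : t = Walk.nil := by simpa using hp.1
        subst ht
        apply hne
        cases q with
        | nil => exact absurd rfl hab
        | cons hadj' t' =>
          rename_i d
          rw [Walk.cons_isPath_iff] at hq
          rw [Walk.edges_cons, List.mem_cons] at he
          rcases he with he | he
          · have hd : d = c := by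
              simp at he; grind
            subst hd
            have : t' = Walk.nil := by simpa using hq.1
            rw [this]
          · exact absurd (t'.fst_mem_support_of_mem_edges he) hq.2

theorem split_cycle {u a b : V} (w : G.Walk u u) (hw : w.IsCycle) (hab : a ≠ b)
    (ha : a ∈ w.support) (hb : b ∈ w.support) :
    ∃ p q : G.Walk a b, DP p q ∧ p ≠ q ∧ (∀ e, e ∈ w.edges ↔ e ∈ p.edges ∨ e ∈ q.edges) ∧
      (∀ y, y ∈ w.support ↔ y ∈ p.support ∨ y ∈ q.support) := by
  classical
  have hc := hw.rotate ha
  have he : ∀ e, e ∈ w.edges ↔ e ∈ (w.rotate a ha).edges := fun e =>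
    ((w.rotate_edges a ha).mem_iff).symm
  have hs : ∀ y, y ∈ w.support ↔ y ∈ (w.rotate a ha).support := fun y => by simp
  generalize w.rotate a ha = c at hc he hs
  obtain ⟨p, q, rfl⟩ := Walk.mem_support_iff_exists_append.1 ((hs b).1 hb)
  have hn := hc.support_nodup
  have htr := hc.isTrail.edges_nodup
  rw [Walk.edges_append, List.nodup_append] at htr
  rw [Walk.tail_support_append, List.nodup_append] at hn
  have hp' : p.support = a :: p.support.tail := p.cons_tail_support.symm
  have hq' : q.support = b :: q.support.tail := q.cons_tail_support.symm
  have hbp : b ∈ p.support := p.end_mem_support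
  have haq : a ∈ q.support := q.end_mem_support
  have hp : p.IsPath := by rw [Walk.isPath_def]; grind
  have hq : q.IsPath := by rw [Walk.isPath_def]; grind
  refine ⟨p, q.reverse, ⟨hp, hq.reverse, ?_⟩, ?_, ?_, ?_⟩
  · intro x hx hx'
    rw [Walk.support_reverse, List.mem_reverse] at hx'
    grind
  · intro h
    cases p with
    | nil => exact absurd rfl hab
    | cons hadj t =>
      rename_i c
      have h1 : s(a, c) ∈ q.reverse.edges := by rw [← h]; simp
      rw [Walk.edges_reverse, List.mem_reverse] at h1
      exact htr.2.2 s(a,c) (by simp) _ h1 rfl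
  · intro e; rw [he]; simp
  · intro e; rw [hs]; simp

theorem BalP.of_balancedOn {Bal : Set (Sym2 V) → Prop} {A : Set V} (h : BalancedOn G Bal A) :
    BalP G Bal A := by
  intro a b p q hab hd hne hA
  refine bal_congr (h a _ (hd.isCycle hab hne) ?_) ?_
  · intro y hy; apply hA; simpa using hy
  · intro e; simp

theorem resplit {x y a b : V} {p q : G.Walk x y} (hxy : x ≠ y) (hd : DP p q) (hne : p ≠ q)
    (hab : a ≠ b) (ha : a ∈ p.support ∨ a ∈ q.support) (hb : b ∈ p.support ∨ b ∈ q.support) :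
    ∃ p' q' : G.Walk a b, DP p' q' ∧ p' ≠ q' ∧
      (∀ e, (e ∈ p.edges ∨ e ∈ q.edges) ↔ e ∈ p'.edges ∨ e ∈ q'.edges) ∧
      (∀ y, (y ∈ p.support ∨ y ∈ q.support) ↔ y ∈ p'.support ∨ y ∈ q'.support) := by
  obtain ⟨p', q', h1, h2, h3, h4⟩ := split_cycle _ (hd.isCycle hxy hne) hab
    (by simpa using ha) (by simpa using hb)
  exact ⟨p', q', h1, h2, by simpa using h3, by simpa using h4⟩

set_option maxHeartbeats 2000000 in
/-- Chord through a connected set. -/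
theorem chord {Bal : Set (Sym2 V) → Prop} (hlin : IsLinearClass G Bal) {R D : Set V}
    (hconn : (G.induce R).Connected) (hRD : R ⊆ D) {a b : V} (hab : a ≠ b) (ha : a ∉ R)
    (hb : b ∉ R) (p q : G.Walk a b) (hd : DP p q)
    (hD : ∀ y, y ∈ p.support ∨ y ∈ q.support → y ∈ D)
    (hp : ∃ x ∈ p.support, x ∈ R) (hq : ∃ x ∈ q.support, x ∈ R)
    (hDa : BalP G Bal (D \ {a})) (hDb : BalP G Bal (D \ {b})) :
    Bal {e | e ∈ p.edges ∨ e ∈ q.edges} := by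
  classical
  obtain ⟨x, hxp, hxR⟩ := hp
  obtain ⟨y, hyq, hyR⟩ := hq
  obtain ⟨w, hwp, hwR⟩ : ∃ w : G.Walk x y, w.IsPath ∧ ∀ z ∈ w.support, z ∈ R := by
    obtain ⟨w0⟩ := hconn.preconnected ⟨x, hxR⟩ ⟨y, hyR⟩
    let w1 : G.Walk x y := w0.map (Embedding.induce R).toHom
    refine ⟨w1.bypass, w1.bypass_isPath, fun z hz => ?_⟩
    have h1 : z ∈ (w0.map (Embedding.induce R).toHom).support := w1.support_bypass_subset_support hz
    rw [Walk.support_map] at h1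
    obtain ⟨z', _, rfl⟩ := List.mem_map.1 h1
    exact z'.2
  obtain ⟨t, w1, w2, rfl, htq, ht⟩ := first_hit {z | z ∈ q.support} w ⟨y, by simp, hyq⟩
  obtain ⟨s, z1, z2, hz, hsp, hs⟩ := first_hit {z | z ∈ p.support} w1.reverse ⟨x, by simp, hxp⟩
  have hw1 : w1.IsPath := ((isPath_append_iff _ _).1 hwp).1
  have hz1 : z1.IsPath := ((isPath_append_iff z1 z2).1 (hz ▸ hw1.reverse)).1
  have hzw : ∀ v ∈ z1.support, v ∈ w1.support := by
    intro v hv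
    have : v ∈ w1.reverse.support := by rw [hz]; simp [hv]
    simpa using this
  have hzR : ∀ v ∈ z1.support, v ∈ R := fun v hv => hwR v (by simp [hzw v hv])
  have hzt : ∀ v ∈ z1.support, v ∈ q.support → v = t := fun v hv h => ht v (hzw v hv) h
  clear hz hzw ht hwR hwp hw1
  simp only [Set.mem_ofPred_eq] at hs hsp htq
  have hsR := hzR s (by simp)
  have htR := hzR t (by simp)
  obtain ⟨p1, p2, rfl⟩ := Walk.mem_support_iff_exists_append.1 hsp
  obtain ⟨q1, q2, rfl⟩ := Walk.mem_support_iff_exists_append.1 htq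
  obtain ⟨hpp, hqp, hd⟩ := hd
  rw [isPath_append_iff] at hpp hqp
  simp only [Walk.mem_support_append_iff] at *
  have e1 := p1.start_mem_support
  have e2 := p1.end_mem_support
  have e3 := p2.start_mem_support
  have e4 := p2.end_mem_support
  have e5 := q1.start_mem_support
  have e6 := q1.end_mem_support
  have e7 := q2.start_mem_support
  have e8 := q2.end_mem_support
  have hst : s ≠ t := by grind
  have hA1 : (p1.reverse.append q1).IsPath := by
    rw [isPath_append_iff]
    refine ⟨hpp.1.reverse, hqp.1, ?_⟩
    simp only [Walk.support_reverse, List.mem_reverse]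
    grind
  have hA2 : (p2.append q2.reverse).IsPath := by
    rw [isPath_append_iff]
    refine ⟨hpp.2.1, hqp.2.1.reverse, ?_⟩
    simp only [Walk.support_reverse, List.mem_reverse]
    grind
  have hz1a : a ∉ z1.support := fun h => ha (hzR _ h)
  have hz1b : b ∉ z1.support := fun h => hb (hzR _ h)
  have hQ1 : ∀ v, v ∈ z1.reverse.support → v ∈ (p1.reverse.append q1).support → v = s ∨ v = t := by
    simp only [Walk.support_reverse, List.mem_reverse, Walk.mem_support_append_iff]
    grind
  have hQ2 : ∀ v, v ∈ z1.reverse.support → v ∈ (p2.append q2.reverse).support → v = s ∨ v = t := by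
    simp only [Walk.support_reverse, List.mem_reverse, Walk.mem_support_append_iff]
    grind
  have h12 : ∀ v, v ∈ (p1.reverse.append q1).support → v ∈ (p2.append q2.reverse).support →
      v = s ∨ v = t := by
    simp only [Walk.support_reverse, List.mem_reverse, Walk.mem_support_append_iff]
    grind
  have key := hlin s t z1.reverse (p1.reverse.append q1) (p2.append q2.reverse)
    ⟨hst, hz1.reverse, hA1, hA2, hQ1, hQ2, h12⟩ ?_ ?_
  · refine bal_congr key ?_
    intro e
    simp only [Set.mem_ofPred_eq, Walk.edges_append, Walk.edges_reverse, List.mem_append,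
      List.mem_reverse]
    tauto
  · refine hDb s t _ _ hst ⟨hz1.reverse, hA1, hQ1⟩ ?_ ?_
    · intro h
      apply hz1a
      have : a ∈ z1.reverse.support := by rw [h]; simp
      simpa using this
    · simp only [Walk.support_reverse, List.mem_reverse, Walk.mem_support_append_iff,
        Set.mem_diff, Set.mem_singleton_iff]
      intro v hv
      refine ⟨?_, ?_⟩
      · rcases hv with hv | hv
        · exact hRD (hzR v hv)
        · exact hD v (by tauto)
      · rintro rfl
        grind
  · refine hDa s t _ _ hst ⟨hz1.reverse, hA2, hQ2⟩ ?_ ?_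
    · intro h
      apply hz1b
      have : b ∈ z1.reverse.support := by rw [h]; simp
      simpa using this
    · simp only [Walk.support_reverse, List.mem_reverse, Walk.mem_support_append_iff,
        Set.mem_diff, Set.mem_singleton_iff]
      intro v hv
      refine ⟨?_, ?_⟩
      · rcases hv with hv | hv
        · exact hRD (hzR v hv)
        · exact hD v (by tauto)
      · rintro rfl
        grind

set_option maxHeartbeats 2000000 in
/-- Rerouting along a balanced part. -/
theorem reroute {Bal : Set (Sym2 V) → Prop} (hlin : IsLinearClass G Bal) {X : Set V} {F : Set (Sym2 V)}
    (hX : ∀ (x y : V) (p q : G.Walk x y), x ≠ y → DP p q → p ≠ q →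
      (∀ v, v ∈ p.support ∨ v ∈ q.support → v ∈ X) → (∀ e, e ∈ p.edges ∨ e ∈ q.edges → e ∈ F) →
      Bal {e | e ∈ p.edges ∨ e ∈ q.edges}) :
    ∀ (n : ℕ) (x b : V) (K r q : G.Walk x b), q.length = n → x ≠ b → DP K r → DP K q →
      (∀ v, v ∈ r.support ∨ v ∈ q.support → v ∈ X) → (∀ e, e ∈ r.edges ∨ e ∈ q.edges → e ∈ F) →
      Bal {e | e ∈ K.edges ∨ e ∈ q.edges} → Bal {e | e ∈ K.edges ∨ e ∈ r.edges} := by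
  intro n
  induction n using Nat.strong_induction_on with
  | _ n ih =>
  intro x b K r q hn hxb hKr hKq hsX heF hbal
  cases q with
  | nil => exact absurd rfl hxb
  | cons hadj t =>
  obtain ⟨y, t1, t2, rfl, hyr, ht⟩ := first_hit {z | z ∈ r.support} t ⟨b, by simp, by simp⟩
  simp only [Set.mem_ofPred_eq] at ht hyr
  rw [← Walk.cons_append] at hn hKq hsX heF hbal
  have hTlen : 0 < (Walk.cons hadj t1).length := by simp
  have hTr : ∀ z ∈ (Walk.cons hadj t1).support, z ∈ r.support → z = x ∨ z = y := by
    intro z hz hzr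
    rw [Walk.support_cons, List.mem_cons] at hz
    rcases hz with h | h
    · exact Or.inl h
    · exact Or.inr (ht z h hzr)
  have hxy : x ≠ y := by
    have := hKq.2.1
    rw [Walk.cons_append, Walk.cons_isPath_iff] at this
    rintro rfl
    exact this.2 (by simp)
  clear ht
  generalize Walk.cons hadj t1 = T at *
  obtain ⟨r1, r2, rfl⟩ := Walk.mem_support_iff_exists_append.1 hyr
  obtain ⟨hK, hr, hKr⟩ := hKr
  obtain ⟨-, hq, hKq⟩ := hKq
  rw [isPath_append_iff] at hr hq
  simp only [Walk.mem_support_append_iff, Walk.edges_append, List.mem_append] at *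
  have e1 := r1.start_mem_support
  have e2 := r1.end_mem_support
  have e3 := r2.start_mem_support
  have e4 := r2.end_mem_support
  have e5 := T.start_mem_support
  have e6 := T.end_mem_support
  have e7 := t2.start_mem_support
  have e8 := t2.end_mem_support
  have e9 := K.start_mem_support
  have e10 := K.end_mem_support
  -- the rerouted cycle is balanced
  have hstep : Bal {e | e ∈ K.edges ∨ e ∈ T.edges ∨ e ∈ r2.edges} := by
    by_cases hyb : y = b
    · subst hyb
      have h1 : r2 = Walk.nil := by simpa using hr.2.1
      have h2 : t2 = Walk.nil := by simpa using hq.2.1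
      subst h1 h2
      exact hbal
    · have hK' : (T.reverse.append K).IsPath := by
        rw [isPath_append_iff]
        refine ⟨hq.1.reverse, hK, ?_⟩
        simp only [Walk.support_reverse, List.mem_reverse]
        grind
      have := ih t2.length (by rw [← hn, Walk.length_append]; omega) y b (T.reverse.append K) r2 t2 rfl
        hyb ⟨hK', hr.2.1, ?_⟩ ⟨hK', hq.2.1, ?_⟩ ?_ ?_ ?_
      · refine bal_congr this ?_
        intro e
        simp only [Set.mem_ofPred_eq, Walk.edges_append, Walk.edges_reverse, List.mem_append,
          List.mem_reverse]
        tauto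
      · simp only [Walk.support_reverse, List.mem_reverse, Walk.mem_support_append_iff]
        grind
      · simp only [Walk.support_reverse, List.mem_reverse, Walk.mem_support_append_iff]
        grind
      · intro v hv; apply hsX; tauto
      · intro v hv; apply heF; tauto
      · refine bal_congr hbal ?_
        intro e
        simp only [Set.mem_ofPred_eq, Walk.edges_append, Walk.edges_reverse, List.mem_append,
          List.mem_reverse]
        tauto
  by_cases hTr1 : T = r1
  · subst hTr1; exact hstep
  have hL : (K.append r2.reverse).IsPath := by
    rw [isPath_append_iff]
    refine ⟨hK, hr.2.1.reverse, ?_⟩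
    simp only [Walk.support_reverse, List.mem_reverse]
    grind
  have hDP : DP T r1 := ⟨hq.1, hr.1, by grind⟩
  have key := hlin x y T r1 (K.append r2.reverse) ⟨hxy, hq.1, hr.1, hL, hDP.2.2, ?_, ?_⟩
    (hX x y T r1 hxy hDP hTr1 (by intro v hv; apply hsX; tauto) (by intro v hv; apply heF; tauto)) ?_
  · refine bal_congr key ?_
    intro e
    simp only [Set.mem_ofPred_eq, Walk.edges_append, Walk.edges_reverse, List.mem_append,
      List.mem_reverse]
    tauto
  · simp only [Walk.support_reverse, List.mem_reverse, Walk.mem_support_append_iff]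
    grind
  · simp only [Walk.support_reverse, List.mem_reverse, Walk.mem_support_append_iff]
    grind
  · refine bal_congr hstep ?_
    intro e
    simp only [Set.mem_ofPred_eq, Walk.edges_append, Walk.edges_reverse, List.mem_append,
      List.mem_reverse]
    tauto

theorem edge_path {a b : V} (p : G.Walk a b) (hp : p.IsPath) (h : s(a, b) ∈ p.edges) :
    ∀ v ∈ p.support, v = a ∨ v = b := by
  cases p with
  | nil => simp at h
  | cons hadj t =>
    rename_i c
    rw [Walk.cons_isPath_iff] at hp
    rw [Walk.edges_cons, List.mem_cons] at h
    rcases h with h | h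
    · have hc : c = b := by
        simp at h; grind
      subst hc
      have ht : t = Walk.nil := by simpa using hp.1
      subst ht
      simp
    · exact absurd (t.fst_mem_support_of_mem_edges h) hp.2

theorem exists_mem_of_not_edge {a b : V} {R : Set V} (hab : a ≠ b) (p : G.Walk a b)
    (h : s(a, b) ∉ p.edges) (hR : ∀ v ∈ p.support, v ∈ R ∪ {a, b}) : ∃ v ∈ p.support, v ∈ R := by
  cases p with
  | nil => exact absurd rfl hab
  | cons hadj t =>
    rename_i c
    have hc : c ∈ (Walk.cons hadj t).support := by simp
    refine ⟨c, hc, ?_⟩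
    rcases hR c hc with h1 | h1 | h1
    · exact h1
    · exact absurd h1 hadj.ne.symm
    · subst h1
      exact absurd (by simp) h

end BG
/-- part of Lemma 5: the set
`S' = V_R ∪ (N(U) ∩ V_{1/2} ∩ S) ∪ (S ∖ N[V_R])` induces a balanced subgraph,
where `U` is the connected component of `v₀` in `G[S ∩ V_R]`. -/
theorem stmt10 {V : Type*} (G : SimpleGraph V) (Bal : Set (Sym2 V) → Prop)
    (hlin : IsLinearClass G Bal) (v0 : V)
    (S VR Vh : Set V) (hv0S : v0 ∈ S) (hv0R : v0 ∈ VR)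
    (hSbal : BalancedOn G Bal S)
    (hVRbal : BalancedOn G Bal VR)
    (hVRconn : (G.induce VR).Connected)
    (hVhN : Vh ⊆ nbhd G VR)
    (hVhV1 : ∀ a ∈ Vh, BalancedOn G Bal (VR ∪ {a}))
    (U S' : Set V)
    (hU : U = {u | ∃ p : G.Walk v0 u, ∀ y ∈ p.support, y ∈ S ∩ VR})
    (hS' : S' = VR ∪ (nbhd G U ∩ Vh ∩ S) ∪ (S \ (VR ∪ nbhd G VR))) :
    BalancedOn G Bal S' := by
  subst hS'
  have hSP := BG.BalP.of_balancedOn hSbal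
  have hRP := BG.BalP.of_balancedOn hVRbal
  -- the key statement by induction on the finite set of vertices outside VR
  have key : ∀ O : Finset V, (∀ v ∈ O, v ∈ (nbhd G U ∩ Vh ∩ S) ∪ (S \ (VR ∪ nbhd G VR))) →
      BG.BalP G Bal (VR ∪ ↑O) := by
    classical
    intro O
    induction O using Finset.strongInduction with
    | H O ih =>
    intro hO x y p q hxy hd hne hsup
    have hOS : ∀ v ∈ O, v ∈ S := by
      intro v hv
      rcases hO v hv with h | h
      · exact h.2
      · exact h.1
    by_cases hr : ∃ r, (r ∈ p.support ∨ r ∈ q.support) ∧ r ∈ VR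
    swap
    · push Not at hr
      refine hSP x y p q hxy hd hne fun v hv => ?_
      rcases hsup v hv with h | h
      · exact absurd h (hr v hv)
      · exact hOS v h
    by_cases ho : ∃ r, (r ∈ p.support ∨ r ∈ q.support) ∧ r ∉ VR
    swap
    · push Not at ho
      exact hRP x y p q hxy hd hne ho
    obtain ⟨r, hr, hrR⟩ := hr
    obtain ⟨o, ho, hoR⟩ := ho
    have hro : r ≠ o := by rintro rfl; exact hoR hrR
    obtain ⟨p', q', hd', hne', he', hs'⟩ := BG.resplit hxy hd hne hro hr ho
    refine BG.bal_congr (s := {e | e ∈ p'.edges ∨ e ∈ q'.edges}) ?_ fun e => (he' e).symm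
    have hsup' : ∀ v, v ∈ p'.support ∨ v ∈ q'.support → v ∈ VR ∪ (O : Set V) :=
      fun v hv => hsup v ((hs' v).2 hv)
    clear he' hs' hr ho hsup hne hd hxy
    clear p q x y
    -- neighbours of VR in O
    have hnb : ∀ a, a ∉ VR → a ∈ VR ∪ (O : Set V) → (∃ c ∈ VR, G.Adj c a) →
        a ∈ O ∧ a ∈ nbhd G U ∧ a ∈ Vh := by
      rintro a haR haO ⟨c, hc, hadj⟩
      have haO : a ∈ O := by
        rcases haO with h | h
        · exact absurd h haR
        · exact h
      refine ⟨haO, ?_⟩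
      rcases hO a haO with h | h
      · exact h.1
      · exact absurd (Or.inr ⟨haR, c, hc, hadj⟩) h.2
    obtain ⟨a, p1, p2, hp12, haR, hpa⟩ := BG.first_hit VRᶜ p' ⟨o, by simp, hoR⟩
    obtain ⟨b, q1, q2, hq12, hbR, hqb⟩ := BG.first_hit VRᶜ q' ⟨o, by simp, hoR⟩
    have hadjlast : ∀ {c : V} (w : G.Walk r c), c ∉ VR → (∀ z ∈ w.support, z ∈ VRᶜ → z = c) →
        w.IsPath → ∃ d ∈ VR, G.Adj d c := by
      intro c w hc hw hwp
      have hnn : ¬ w.Nil := Walk.not_nil_of_ne (by rintro rfl; exact hc hrR)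
      refine ⟨w.penultimate, ?_, w.adj_penultimate hnn⟩
      by_contra hcon
      have h1 := hw _ (w.getVert_mem_support _) hcon
      exact (w.adj_penultimate hnn).ne h1
    subst hp12 hq12
    obtain ⟨hpp, hqp, hdd⟩ := hd'
    rw [BG.isPath_append_iff] at hpp hqp
    simp only [Walk.mem_support_append_iff] at hdd hsup'
    have e1 := p1.start_mem_support
    have e2 := p1.end_mem_support
    have e3 := p2.start_mem_support
    have e4 := p2.end_mem_support
    have e5 := q1.start_mem_support
    have e6 := q1.end_mem_support
    have e7 := q2.start_mem_support
    have e8 := q2.end_mem_support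
    obtain ⟨haO, haU, haH⟩ := hnb a haR (hsup' a (by tauto)) (hadjlast p1 haR hpa hpp.1)
    obtain ⟨hbO, hbU, hbH⟩ := hnb b hbR (hsup' b (by tauto)) (hadjlast q1 hbR hqb hqp.1)
    have haR' : a ∉ VR := haR
    have hbR' : b ∉ VR := hbR
    simp only [Set.mem_compl_iff] at hpa hqb
    by_cases hab : a = b
    · subst hab
      have hao : a = o := by
        rcases hdd a (by tauto) (by tauto) with h | h
        · exact absurd (h ▸ hrR) haR'
        · exact h
      subst hao
      have h1 : p2 = Walk.nil := by simpa using hpp.2.1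
      have h2 : q2 = Walk.nil := by simpa using hqp.2.1
      subst h1 h2
      simp only [Walk.append_nil] at hne' ⊢
      refine BG.BalP.of_balancedOn (hVhV1 a haH) r a p1 q1 hro ⟨hpp.1, hqp.1, ?_⟩ hne' ?_
      · intro v h1 h2; exact hdd v (by tauto) (by tauto)
      · intro v hv
        by_cases hvR : v ∈ VR
        · exact Or.inl hvR
        · right
          rcases hv with hv | hv
          · exact hpa v hv hvR
          · exact hqb v hv hvR
    -- the two arcs from a to b
    have hA1 : (p1.reverse.append q1).IsPath := by
      rw [BG.isPath_append_iff]
      refine ⟨hpp.1.reverse, hqp.1, ?_⟩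
      simp only [Walk.support_reverse, List.mem_reverse]
      intro v h1 h2
      rcases hdd v (by tauto) (by tauto) with h | h
      · exact h
      · subst h
        exact absurd ((hpa v h1 hoR).symm.trans (hqb v h2 hoR)) hab
    have hA2 : (p2.append q2.reverse).IsPath := by
      rw [BG.isPath_append_iff]
      refine ⟨hpp.2.1, hqp.2.1.reverse, ?_⟩
      simp only [Walk.support_reverse, List.mem_reverse]
      grind
    have hA12 : BG.DP (p1.reverse.append q1) (p2.append q2.reverse) := by
      refine ⟨hA1, hA2, ?_⟩
      simp only [Walk.support_reverse, List.mem_reverse, Walk.mem_support_append_iff]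
      grind
    have hA1R : ∀ v ∈ (p1.reverse.append q1).support, v ∈ VR ∪ {a, b} := by
      simp only [Walk.support_reverse, List.mem_reverse, Walk.mem_support_append_iff]
      intro v hv
      by_cases hvR : v ∈ VR
      · exact Or.inl hvR
      · right
        rcases hv with hv | hv
        · exact Or.inl (hpa v hv hvR)
        · exact Or.inr (hqb v hv hvR)
    have hA1r : r ∈ (p1.reverse.append q1).support := by simp
    have hsupA : ∀ v, v ∈ (p1.reverse.append q1).support ∨ v ∈ (p2.append q2.reverse).support →
        v ∈ VR ∪ (O : Set V) := by
      simp only [Walk.support_reverse, List.mem_reverse, Walk.mem_support_append_iff]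
      intro v hv
      apply hsup'; tauto
    refine BG.bal_congr (s := {e | e ∈ (p1.reverse.append q1).edges ∨
      e ∈ (p2.append q2.reverse).edges}) ?_ ?_
    swap
    · intro e
      simp only [Set.mem_ofPred_eq, Walk.edges_append, Walk.edges_reverse, List.mem_append,
        List.mem_reverse]
      tauto
    generalize p1.reverse.append q1 = R at *
    generalize p2.append q2.reverse = P at *
    clear hpp hqp hdd hsup' hne' e1 e2 e3 e4 e5 e6 e7 e8 hpa hqb
    clear p1 p2 q1 q2
    by_cases hPR : ∃ v ∈ P.support, v ∈ VR
    · have hsub : ∀ c, (VR ∪ (O : Set V)) \ {c} ⊆ VR ∪ ↑(O.erase c) := by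
        rintro c v ⟨hv | hv, hvc⟩
        · exact Or.inl hv
        · right
          exact Finset.mem_coe.2 (Finset.mem_erase.2 ⟨hvc, hv⟩)
      refine BG.chord hlin hVRconn (Set.subset_union_left) hab haR' hbR' R P hA12 hsupA
        ⟨r, hA1r, hrR⟩ hPR ?_ ?_
      · exact (ih _ (Finset.erase_ssubset haO) fun v hv => hO v (Finset.mem_of_mem_erase hv)).mono
          (hsub a)
      · exact (ih _ (Finset.erase_ssubset hbO) fun v hv => hO v (Finset.mem_of_mem_erase hv)).mono
          (hsub b)
    push Not at hPR
    have hPS : ∀ v ∈ P.support, v ∈ S := by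
      intro v hv
      rcases hsupA v (Or.inr hv) with h | h
      · exact absurd h (hPR v hv)
      · exact hOS v h
    -- the path through U
    obtain ⟨Q, hQp, hQR, hQ⟩ : ∃ Q : G.Walk a b, Q.IsPath ∧ (∃ v ∈ Q.support, v ∈ VR) ∧
        ∀ v ∈ Q.support, v = a ∨ v = b ∨ v ∈ S ∩ VR := by
      obtain ⟨-, ua, hua, haa⟩ := haU
      obtain ⟨-, ub, hub, hbb⟩ := hbU
      rw [hU] at hua hub
      obtain ⟨wa, hwa⟩ := hua
      obtain ⟨wb, hwb⟩ := hub
      obtain ⟨W, hWp, hW⟩ : ∃ W : G.Walk ua ub, W.IsPath ∧ ∀ v ∈ W.support, v ∈ S ∩ VR := by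
        refine ⟨(wa.reverse.append wb).bypass, Walk.bypass_isPath _, fun v hv => ?_⟩
        have hv' := Walk.support_bypass_subset_support _ hv
        simp only [Walk.mem_support_append_iff, Walk.support_reverse, List.mem_reverse] at hv'
        rcases hv' with h | h
        · exact hwa v h
        · exact hwb v h
      refine ⟨Walk.cons haa.symm (W.append (Walk.cons hbb Walk.nil)), ?_, ⟨ua, by simp, ?_⟩, ?_⟩
      · have haW : a ∉ W.support := fun h => haR' (hW _ h).2
        have hbW : b ∉ W.support := fun h => hbR' (hW _ h).2
        rw [Walk.cons_isPath_iff, BG.isPath_append_iff]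
        refine ⟨⟨hWp, by simpa using hbb.ne, ?_⟩, ?_⟩
        · intro v h1 h2
          simp only [Walk.support_cons, Walk.support_nil, List.mem_cons, List.not_mem_nil,
            or_false] at h2
          rcases h2 with h2 | h2
          · exact h2
          · subst h2; exact absurd h1 hbW
        · intro h
          simp only [Walk.mem_support_append_iff, Walk.support_cons, Walk.support_nil,
            List.mem_cons, List.not_mem_nil, or_false] at h
          rcases h with h | h | h
          · exact haW h
          · subst h; exact haW W.end_mem_support
          · exact hab h
      · exact (hW _ W.start_mem_support).2
      · intro v hv
        simp only [Walk.mem_support_append_iff, Walk.support_cons, Walk.support_nil,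
          List.mem_cons, List.not_mem_nil, or_false] at hv
        rcases hv with h | h | h | h
        · exact Or.inl h
        · exact Or.inr (Or.inr (hW v h))
        · subst h; exact Or.inr (Or.inr (hW _ W.end_mem_support))
        · exact Or.inr (Or.inl h)
    have hPQ : BG.DP P Q := by
      refine ⟨hA2, hQp, fun v h1 h2 => ?_⟩
      rcases hQ v h2 with h | h | h
      · exact Or.inl h
      · exact Or.inr h
      · exact absurd h.2 (hPR v h1)
    have hbalPQ : Bal {e | e ∈ P.edges ∨ e ∈ Q.edges} := by
      refine hSP a b P Q hab hPQ ?_ ?_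
      · rintro rfl
        obtain ⟨v, hv, hvR⟩ := hQR
        exact hPR v hv hvR
      · rintro v (hv | hv)
        · exact hPS v hv
        · rcases hQ v hv with h | h | h
          · subst h; exact hOS _ haO
          · subst h; exact hOS _ hbO
          · exact h.1
    have hnoedge : ∀ T : G.Walk a b, T.IsPath → (∃ v ∈ T.support, v ∈ VR) →
        s(a, b) ∉ T.edges := by
      rintro T hT ⟨v, hv, hvR⟩ he
      rcases BG.edge_path T hT he v hv with h | h
      · exact haR' (h ▸ hvR)
      · exact hbR' (h ▸ hvR)
    have hRe := hnoedge R hA1 ⟨r, hA1r, hrR⟩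
    have hQe := hnoedge Q hQp hQR
    have hDa : BG.BalP G Bal ((VR ∪ {a, b}) \ {a}) := by
      refine (BG.BalP.of_balancedOn (hVhV1 b hbH)).mono ?_
      rintro v ⟨h | h | h, hva⟩
      · exact Or.inl h
      · exact absurd h hva
      · exact Or.inr h
    have hDb : BG.BalP G Bal ((VR ∪ {a, b}) \ {b}) := by
      refine (BG.BalP.of_balancedOn (hVhV1 a haH)).mono ?_
      rintro v ⟨h | h | h, hva⟩
      · exact Or.inl h
      · exact Or.inr h
      · exact absurd h hva
    refine BG.bal_congr (s := {e | e ∈ P.edges ∨ e ∈ R.edges}) ?_ (fun e => or_comm)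
    refine BG.reroute hlin (X := VR ∪ {a, b}) (F := {e | e ≠ s(a, b)}) ?_ Q.length a b P R Q rfl hab
      ⟨hA2, hA1, fun v h1 h2 => hA12.2.2 v h2 h1⟩ hPQ ?_ ?_ hbalPQ
    · intro x y p q hxy hd hne hX hF
      by_cases ha : a ∈ p.support ∨ a ∈ q.support
      swap
      · exact hDa x y p q hxy hd hne fun v hv => ⟨hX v hv, by rintro rfl; exact ha hv⟩
      by_cases hb : b ∈ p.support ∨ b ∈ q.support
      swap
      · exact hDb x y p q hxy hd hne fun v hv => ⟨hX v hv, by rintro rfl; exact hb hv⟩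
      obtain ⟨p', q', hd', hne', he', hs'⟩ := BG.resplit hxy hd hne hab ha hb
      refine BG.bal_congr (s := {e | e ∈ p'.edges ∨ e ∈ q'.edges}) ?_ fun e => (he' e).symm
      refine BG.chord hlin hVRconn (Set.subset_union_left) hab haR' hbR' p' q' hd'
        (fun v hv => hX v ((hs' v).2 hv)) ?_ ?_ hDa hDb
      · exact BG.exists_mem_of_not_edge hab p' (fun h => hF _ ((he' _).2 (Or.inl h)) rfl)
          fun v hv => hX v ((hs' v).2 (Or.inl hv))
      · exact BG.exists_mem_of_not_edge hab q' (fun h => hF _ ((he' _).2 (Or.inr h)) rfl)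
          fun v hv => hX v ((hs' v).2 (Or.inr hv))
    · rintro v (hv | hv)
      · exact hA1R v hv
      · rcases hQ v hv with h | h | h
        · exact Or.inr (Or.inl h)
        · exact Or.inr (Or.inr h)
        · exact Or.inl h.2
    · rintro e (he | he) rfl
      · exact hRe he
      · exact hQe he
  intro u w hw hsup
  classical
  have hnn : ¬ w.Nil := hw.not_nil
  have hadj := w.adj_snd hnn
  obtain ⟨p, q, hd, hne, he, hs⟩ := BG.split_cycle w hw hadj.ne w.start_mem_support
    (w.getVert_mem_support _)
  refine BG.bal_congr (key (w.support.toFinset.filter (· ∉ VR)) ?_ _ _ p q hadj.ne hd hne ?_)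
    fun e => (he e).symm
  · intro v hv
    rw [Finset.mem_filter, List.mem_toFinset] at hv
    rcases hsup v hv.1 with (h | h) | h
    · exact absurd h hv.2
    · exact Or.inl h
    · exact Or.inr h
  · intro v hv
    by_cases hvR : v ∈ VR
    · exact Or.inl hvR
    · right
      rw [Finset.mem_coe, Finset.mem_filter, List.mem_toFinset]
      exact ⟨(hs v).2 hv, hvR⟩
end

section
/- Let (G, B) be a biased graph with root v₀ and nonnegative vertex costs c, and suppose the half-integral assignment x = 1·V₁ + ½·V_{1/2} (from an LP optimum with reachable region V_R, where V₁ = N(V_R) vertices with value 1 and V_{1/2} = N(V_R)∖V₁) is an optimum of the local balloon LP. Then X = V₁ ∪ V_{1/2} = N(V_R) is a feasible integral solution to the rooted cleaning problem with c(X) ≤ 2·λ, where λ is the LP optimum value; i.e., rounding up the half-integral optimum gives a 2-approximation. -/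
open SimpleGraph

/-- Length of a walk under the metric `ℓ_x(uv) = (x_u + x_v)/2`. -/
noncomputable def walkLen {V : Type*} {G : SimpleGraph V} (x : V → ℝ) {u v : V} (w : G.Walk u v) : ℝ :=
  (w.darts.map fun d => (x d.toProd.1 + x d.toProd.2) / 2).sum

/-- A `v₀`-balloon: an unbalanced simple cycle `C` through the knot vertex `t`,
together with a simple path `P` from `v₀` to `t` internally disjoint from `C`. -/
def IsBalloon {V : Type*} (G : SimpleGraph V) (Bal : Set (Sym2 V) → Prop)
    (v0 t : V) (P : G.Walk v0 t) (C : G.Walk t t) : Prop :=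
  P.IsPath ∧ C.IsCycle ∧ ¬ Bal {e | e ∈ C.edges} ∧
  ∀ y, y ∈ P.support → y ∈ C.support → y = t

/-- Balloon weight `w(B) = 2 w(P) + w(C)`: coefficient 2 on path vertices (knot counted
`2·(1/2)+1 = 2` overall), coefficient 1 on the other cycle vertices. -/
noncomputable def balloonWeight {V : Type*} {G : SimpleGraph V} {v0 t : V} (x : V → ℝ)
    (P : G.Walk v0 t) (C : G.Walk t t) : ℝ :=
  2 * ((P.support.map x).sum - x t / 2) + (C.support.tail.map x).sum

/-- Shortest-path distance from `v₀` under `ℓ_x`. -/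
noncomputable def zdist {V : Type*} (G : SimpleGraph V) (x : V → ℝ) (v0 v : V) : ℝ :=
  sInf {r : ℝ | ∃ p : G.Walk v0 v, walkLen x p = r}

/-- Feasibility for the local balloon-covering LP. -/
def LPfeasible {V : Type*} (G : SimpleGraph V) (Bal : Set (Sym2 V) → Prop)
    (v0 : V) (x : V → ℝ) : Prop :=
  (∀ v, 0 ≤ x v) ∧ x v0 = 0 ∧
  ∀ (t : V) (P : G.Walk v0 t) (C : G.Walk t t),
    IsBalloon G Bal v0 t P C → 1 ≤ balloonWeight x P C

theorem first_hit {V : Type*} {G : SimpleGraph V} (S : Set V) {a b : V} (p : G.Walk a b)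
    (hb : b ∈ S) : ∃ t ∈ S, ∃ P : G.Walk a t, (∀ y ∈ P.support, y ∈ p.support) ∧
      ∀ y ∈ P.support, y ∈ S → y = t := by
  classical
  induction p with
  | nil => exact ⟨_, hb, Walk.nil, by simp, by simp⟩
  | @cons a c b h p ih =>
    by_cases ha : a ∈ S
    · exact ⟨a, ha, Walk.nil, by simp, by simp⟩
    · obtain ⟨t, ht, P, h1, h2⟩ := ih hb
      refine ⟨t, ht, Walk.cons h P, ?_, ?_⟩
      · intro y hy
        rw [Walk.support_cons, List.mem_cons] at hy ⊢
        exact hy.imp id (h1 y)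
      · intro y hy hyS
        rw [Walk.support_cons, List.mem_cons] at hy
        rcases hy with rfl | hy
        · exact absurd hyS ha
        · exact h2 y hy hyS

theorem stay_in {V : Type*} {G : SimpleGraph V} (S : Set V) {a b : V} (p : G.Walk a b)
    (ha : a ∈ S) (hp : ∀ y ∈ p.support, y ∉ nbhd G S) : ∀ y ∈ p.support, y ∈ S := by
  induction p with
  | nil => simpa using ha
  | @cons a c b h p ih =>
    have hc : c ∈ S := by
      by_contra hcS
      exact hp c (by simp) ⟨hcS, a, ha, h⟩
    intro y hy
    rw [Walk.support_cons, List.mem_cons] at hy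
    rcases hy with rfl | hy
    · exact ha
    · exact ih hc (fun z hz => hp z (by simp [hz])) y hy

/-- rounding the half-integral optimum up gives a feasible integral
solution `X = N(V_R)` of cost at most twice the LP optimum `λ = cᵀxh`. -/
theorem stmt16 {V : Type*} [Fintype V] (G : SimpleGraph V)
    (Bal : Set (Sym2 V) → Prop) (v0 : V) (c : V → ℝ) (hc : ∀ v, 0 ≤ c v)
    (xs : V → ℝ) (hfeas : LPfeasible G Bal v0 xs)
    (hopt : ∀ y : V → ℝ, LPfeasible G Bal v0 y →
      ∑ v, c v * xs v ≤ ∑ v, c v * y v)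
    (VR V1 Vh : Set V)
    (hVR : VR = {v | ∃ p : G.Walk v0 v, walkLen xs p = 0})
    (hV1 : V1 = nbhd G VR ∩ {v | xs v = 1})
    (hVh : Vh = nbhd G VR \ V1)
    (xh : V → ℝ)
    (hxh : xh = fun v => V1.indicator (fun _ => (1 : ℝ)) v
      + Vh.indicator (fun _ => (1 / 2 : ℝ)) v)
    (hhfeas : LPfeasible G Bal v0 xh)
    (hhopt : ∀ y : V → ℝ, LPfeasible G Bal v0 y →
      ∑ v, c v * xh v ≤ ∑ v, c v * y v) :
    V1 ∪ Vh = nbhd G VR ∧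
    BalancedOn G Bal
      {u | ∃ p : G.Walk v0 u, ∀ y ∈ p.support, y ∉ nbhd G VR} ∧
    ∑ v, (nbhd G VR).indicator c v ≤ 2 * ∑ v, c v * xh v := by
  classical
  have hsub : V1 ⊆ nbhd G VR := by rw [hV1]; exact Set.inter_subset_left
  have hun : V1 ∪ Vh = nbhd G VR := by rw [hVh]; exact Set.union_sdiff_cancel hsub
  refine ⟨hun, ?_, ?_⟩
  · intro u w hw hwA
    by_contra hnb
    have hv0 : v0 ∈ VR := by
      rw [hVR]; exact ⟨Walk.nil, by simp [walkLen]⟩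
    have hz : ∀ v ∈ VR, xh v = 0 := by
      intro v hv
      have hn : v ∉ nbhd G VR := fun h => h.1 hv
      have h1 : v ∉ V1 := fun h => hn (hsub h)
      have h2 : v ∉ Vh := fun h => hn (hun ▸ Or.inr h)
      simp [hxh, h1, h2]
    have hwR : ∀ y ∈ w.support, y ∈ VR := by
      intro y hy
      obtain ⟨p, hp⟩ := hwA y hy
      exact stay_in VR p hv0 hp y p.end_mem_support
    obtain ⟨p, hp⟩ := hwA u w.start_mem_support
    have hpR := stay_in VR p hv0 hp
    obtain ⟨t, ht, P, hP1, hP2⟩ := first_hit {y | y ∈ w.support} p w.start_mem_support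
    have ht' : t ∈ w.support := ht
    have hmem : ∀ y, y ∈ (w.rotate t ht').support → y ∈ w.support := by
      intro y hy
      exact (Walk.mem_support_rotate_iff w t ht').1 hy
    have hB : IsBalloon G Bal v0 t P.bypass (w.rotate t ht') := by
      refine ⟨P.bypass_isPath, hw.rotate ht', ?_, ?_⟩
      · have he : {e | e ∈ (w.rotate t ht').edges} = {e | e ∈ w.edges} := by
          ext e
          exact (w.rotate_edges t ht').mem_iff
        rwa [he]
      · intro y hy hy'
        exact hP2 y (P.support_bypass_subset_support hy) (hmem y hy')
    have h1 := hhfeas.2.2 t _ _ hB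
    have hs1 : (P.bypass.support.map xh).sum = 0 := by
      apply List.sum_eq_zero
      intro r hr
      obtain ⟨y, hy, rfl⟩ := List.mem_map.1 hr
      exact hz y (hpR y (hP1 y (P.support_bypass_subset_support hy)))
    have hs2 : ((w.rotate t ht').support.tail.map xh).sum = 0 := by
      apply List.sum_eq_zero
      intro r hr
      obtain ⟨y, hy, rfl⟩ := List.mem_map.1 hr
      exact hz y (hwR y (hmem y (List.mem_of_mem_tail hy)))
    have ht0 := hz t (hwR t ht')
    unfold balloonWeight at h1
    rw [hs1, hs2, ht0] at h1
    norm_num at h1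
  · rw [Finset.mul_sum]
    apply Finset.sum_le_sum
    intro v _
    have hcv := hc v
    by_cases hv : v ∈ nbhd G VR
    · by_cases h1 : v ∈ V1
      · have h2 : v ∉ Vh := by rw [hVh]; exact fun h => h.2 h1
        simp [hxh, hv, h1, h2]; linarith
      · have h2 : v ∈ Vh := by rw [hVh]; exact ⟨hv, h1⟩
        simp [hxh, hv, h1, h2]; linarith
    · have h1 : v ∉ V1 := fun h => hv (hsub h)
      have h2 : v ∉ Vh := fun h => hv (hun ▸ Or.inr h)
      simp [hxh, hv, h1, h2]
end
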